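/- Let n be even with 2 ≤ n ≤ 10, let α = 1, and let q_1 > q_2 > … > q_n be real numbers. Let Q be the n×n skew-symmetric matrix with Q_{ij} = q_{ij}|q_{ij}|^{−3} (so Q_{ij} = q_{ij}^{−2} for i < j), where q_{ij} = q_i − q_j. Then Pf Q > 0. -/

import Mathlib

open scoped BigOperators

/-- The Pfaffian of an `n × n` real matrix (intended for skew-symmetric matrices
with `n` even), given by the formula
`Pf A = (1/(2^k k!)) ∑_{σ ∈ S_{2k}} sgn(σ) ∏_{i=1}^k A_{σ(2i-1),σ(2i)}` with `k = n/2`. -/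
noncomputable def Pf {n : ℕ} (A : Matrix (Fin n) (Fin n) ℝ) : ℝ :=
  (1 / (2 ^ (n / 2) * (Nat.factorial (n / 2)) : ℝ)) *
    ∑ σ : Equiv.Perm (Fin n), ((Equiv.Perm.sign σ : ℤ) : ℝ) *
      ∏ i : Fin (n / 2),
        A (σ ⟨2 * i.val, by have := i.isLt; omega⟩)
          (σ ⟨2 * i.val + 1, by have := i.isLt; omega⟩)

section Aux
open Equiv

def e0 {k : ℕ} (i : Fin k) : Fin (2*k) := ⟨2*i.val, by omega⟩
def e1 {k : ℕ} (i : Fin k) : Fin (2*k) := ⟨2*i.val+1, by omega⟩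
def low {k : ℕ} (x : Fin (2*k)) : Fin (2*(k+1)) := ⟨x.val, by omega⟩
def hi (k : ℕ) (x : Fin 2) : Fin (2*(k+1)) := ⟨2*k+x.val, by omega⟩

def MM (k : ℕ) (K : Fin k → Fin (2*k) → Fin (2*k) → ℤ) : ℤ :=
  ∑ σ : Perm (Fin (2*k)), (Perm.sign σ : ℤ) * ∏ i, K i (σ (e0 i)) (σ (e1 i))

def splitE (k : ℕ) : Fin (2*k) ⊕ Fin 2 ≃ Fin (2*(k+1)) := finSumFinEquiv (m := 2*k) (n := 2)

lemma splitE_inl (k : ℕ) (x : Fin (2*k)) : splitE k (Sum.inl x) = low x := rfl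
lemma splitE_inr (k : ℕ) (x : Fin 2) : splitE k (Sum.inr x) = hi k x := rfl

/-- extension of a pair of permutations to `Fin (2*(k+1))` -/
def extP (k : ℕ) (π : Perm (Fin (2*k)) × Perm (Fin 2)) : Perm (Fin (2*(k+1))) :=
  (splitE k).permCongr (Perm.sumCongr π.1 π.2)

lemma extP_low (k : ℕ) (π : Perm (Fin (2*k)) × Perm (Fin 2)) (x : Fin (2*k)) :
    extP k π (low x) = low (π.1 x) := by
  rw [← splitE_inl, ← splitE_inl]
  simp [extP, Equiv.permCongr_apply]

lemma extP_hi (k : ℕ) (π : Perm (Fin (2*k)) × Perm (Fin 2)) (x : Fin 2) :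
    extP k π (hi k x) = hi k (π.2 x) := by
  rw [← splitE_inr, ← splitE_inr]
  simp [extP, Equiv.permCongr_apply]

lemma extP_sign (k : ℕ) (π : Perm (Fin (2*k)) × Perm (Fin 2)) :
    Perm.sign (extP k π) = Perm.sign π.1 * Perm.sign π.2 := by
  simp only [extP]
  rw [Perm.sign_permCongr, Perm.sign_sumCongr]

lemma extP_inj (k : ℕ) : Function.Injective (extP k) := by
  intro π π' h
  have h2 := (Equiv.permCongr _).injective h
  exact Perm.sumCongrHom_injective h2

lemma extP_surj (k : ℕ) (σ : Perm (Fin (2*(k+1))))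
    (h : ∀ x : Fin (2*(k+1)), x.val < 2*k → (σ x).val < 2*k) : ∃ π, extP k π = σ := by
  have key := Perm.mem_sumCongrHom_range_of_perm_mapsTo_inl
    (σ := (splitE k).symm.permCongr σ) ?_
  · obtain ⟨π, hπ⟩ := key
    refine ⟨π, ?_⟩
    unfold extP
    have h3 : Perm.sumCongr π.1 π.2 = (splitE k).symm.permCongr σ := hπ
    rw [h3]
    ext x
    simp [Equiv.permCongr_apply]
  · rintro _ ⟨x, rfl⟩
    have := h (low x) x.isLt
    rw [Equiv.permCongr_apply]
    simp only [Equiv.symm_symm, splitE_inl]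
    refine ⟨⟨(σ (low x)).val, this⟩, ?_⟩
    rw [Equiv.eq_symm_apply]
    rfl

lemma sum_last (k : ℕ) (K : Fin (k+1) → Fin (2*(k+1)) → Fin (2*(k+1)) → ℤ)
    (hK : ∀ i x y, K i x y = - K i y x) :
    ∑ σ : Perm (Fin (2*(k+1))) with
        ((σ.symm (hi k 0)).val / 2 = k ∧ (σ.symm (hi k 1)).val / 2 = k),
      (Perm.sign σ : ℤ) * ∏ i, K i (σ (e0 i)) (σ (e1 i))
    = 2 * K (Fin.last k) (hi k 0) (hi k 1) *
      MM k (fun i x y => K i.castSucc (low x) (low y)) := by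
  have h1 : ∑ σ : Perm (Fin (2*(k+1))) with
        ((σ.symm (hi k 0)).val / 2 = k ∧ (σ.symm (hi k 1)).val / 2 = k),
      (Perm.sign σ : ℤ) * ∏ i, K i (σ (e0 i)) (σ (e1 i)) =
      ∑ π : Perm (Fin (2*k)) × Perm (Fin 2),
      (Perm.sign (extP k π) : ℤ) * ∏ i, K i (extP k π (e0 i)) (extP k π (e1 i)) := by
    symm
    refine Finset.sum_bij (fun π _ => extP k π) ?_ (fun a _ b _ h => extP_inj k h) ?_
      (fun _ _ => rfl)
    · intro π _
      simp only [Finset.mem_filter, Finset.mem_univ, true_and]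
      have : ∀ x, (extP k π).symm (hi k x) = hi k (π.2.symm x) := by
        intro x
        rw [Equiv.symm_apply_eq, extP_hi]; simp
      rw [this, this]
      simp only [hi]
      constructor <;> omega
    · intro σ hσ
      simp only [Finset.mem_filter, Finset.mem_univ, true_and] at hσ
      obtain ⟨π, h⟩ := extP_surj k σ (by
        intro x hx
        by_contra hc
        have hl := (σ x).isLt
        rcases (by omega : (σ x).val = 2*k ∨ (σ x).val = 2*k+1) with h | h
        · have : σ x = hi k 0 := Fin.ext h
          rw [← this] at hσ
          simp at hσ
          omega
        · have : σ x = hi k 1 := Fin.ext h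
          rw [← this] at hσ
          simp at hσ
          omega)
      exact ⟨π, Finset.mem_univ _, h⟩
  rw [h1, Fintype.sum_prod_type, MM, Finset.mul_sum]
  refine Finset.sum_congr rfl fun π _ => ?_
  have h2 : (Finset.univ : Finset (Perm (Fin 2))) = {1, swap 0 1} := by decide
  have ea : ∀ i : Fin k, (e0 i.castSucc : Fin (2*(k+1))) = low (e0 i) := fun _ => rfl
  have eb : ∀ i : Fin k, (e1 i.castSucc : Fin (2*(k+1))) = low (e1 i) := fun _ => rfl
  have ec : (e0 (Fin.last k) : Fin (2*(k+1))) = hi k 0 := rfl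
  have ed : (e1 (Fin.last k) : Fin (2*(k+1))) = hi k 1 := rfl
  simp only [Fin.prod_univ_castSucc, ea, eb, ec, ed, extP_low, extP_hi, extP_sign]
  rw [h2, Finset.sum_pair (by decide)]
  simp only [Perm.sign_one, Perm.sign_swap (show (0 : Fin 2) ≠ 1 by decide), Perm.one_apply,
    swap_apply_left, swap_apply_right]
  rw [hK (Fin.last k) (hi k 1) (hi k 0)]
  push_cast
  ring

/-- the swap of the pair of slots `i` and the last pair -/
def rho (k : ℕ) (i : Fin (k+1)) : Perm (Fin (2*(k+1))) :=
  swap (e0 i) (e0 (Fin.last k)) * swap (e1 i) (e1 (Fin.last k))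

lemma e0_inj {k : ℕ} {i j : Fin k} : e0 i = e0 j ↔ i = j := by
  simp [e0, Fin.ext_iff]
lemma e1_inj {k : ℕ} {i j : Fin k} : e1 i = e1 j ↔ i = j := by
  simp [e1, Fin.ext_iff]
lemma e0_ne_e1 {k : ℕ} {i j : Fin k} : e0 i ≠ e1 j := by
  simp [e0, e1, Fin.ext_iff]; omega
lemma e1_ne_e0 {k : ℕ} {i j : Fin k} : e1 i ≠ e0 j := by
  simp [e0, e1, Fin.ext_iff]; omega

lemma rho_e0 (k : ℕ) (i j : Fin (k+1)) : rho k i (e0 j) = e0 (swap i (Fin.last k) j) := by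
  simp only [rho, Perm.mul_apply]
  rw [swap_apply_of_ne_of_ne e0_ne_e1 e0_ne_e1]
  simp only [swap_apply_def, e0_inj]
  split_ifs <;> rfl

lemma rho_e1 (k : ℕ) (i j : Fin (k+1)) : rho k i (e1 j) = e1 (swap i (Fin.last k) j) := by
  simp only [rho, Perm.mul_apply]
  have : swap (e1 i) (e1 (Fin.last k)) (e1 j) = e1 (swap i (Fin.last k) j) := by
    simp only [swap_apply_def, e1_inj]
    split_ifs <;> rfl
  rw [this, swap_apply_of_ne_of_ne e1_ne_e0 e1_ne_e0]

lemma rho_sign (k : ℕ) (i : Fin (k+1)) : Perm.sign (rho k i) = 1 := by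
  rw [rho, Perm.sign_mul]
  by_cases h : i = Fin.last k
  · simp [h]
  · rw [Perm.sign_swap (by rwa [Ne, e0_inj]), Perm.sign_swap (by rwa [Ne, e1_inj])]; rfl

lemma slot_cases {k : ℕ} (x : Fin (2*k)) : ∃ j : Fin k, j.val = x.val / 2 ∧ (x = e0 j ∨ x = e1 j) := by
  refine ⟨⟨x.val/2, by omega⟩, rfl, ?_⟩
  simp only [e0, e1, Fin.ext_iff]; omega

lemma e0_div {k : ℕ} (i : Fin k) : (e0 i).val / 2 = i.val := by simp [e0]
lemma e1_div {k : ℕ} (i : Fin k) : (e1 i).val / 2 = i.val := by simp [e1]; omega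

lemma rho_div (k : ℕ) (i : Fin (k+1)) (x : Fin (2*(k+1))) :
    (rho k i x).val / 2 = k ↔ x.val / 2 = i.val := by
  obtain ⟨j, hj, h | h⟩ := slot_cases x
  · rw [h, rho_e0, e0_div, e0_div]
    constructor
    · intro h2
      have : swap i (Fin.last k) j = Fin.last k := Fin.ext h2
      rw [swap_apply_eq_iff, swap_apply_right] at this
      rw [this]
    · intro h2
      have : j = i := Fin.ext h2
      simp [this]
  · rw [h, rho_e1, e1_div, e1_div]
    constructor
    · intro h2
      have : swap i (Fin.last k) j = Fin.last k := Fin.ext h2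
      rw [swap_apply_eq_iff, swap_apply_right] at this
      rw [this]
    · intro h2
      have : j = i := Fin.ext h2
      simp [this]

lemma sum_pair_i (k : ℕ) (K : Fin (k+1) → Fin (2*(k+1)) → Fin (2*(k+1)) → ℤ)
    (hK : ∀ i x y, K i x y = - K i y x) (i : Fin (k+1)) :
    ∑ σ : Perm (Fin (2*(k+1))) with
        ((σ.symm (hi k 0)).val / 2 = i.val ∧ (σ.symm (hi k 1)).val / 2 = i.val),
      (Perm.sign σ : ℤ) * ∏ i, K i (σ (e0 i)) (σ (e1 i))
    = 2 * K i (hi k 0) (hi k 1) *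
      MM k (fun j x y => K (swap i (Fin.last k) j.castSucc) (low x) (low y)) := by
  have h := sum_last k (fun j => K (swap i (Fin.last k) j)) (fun _ _ _ => hK _ _ _)
  simp only [swap_apply_right] at h
  rw [← h]
  have hinv : rho k i * rho k i = 1 := by
    ext x
    obtain ⟨j, hj, h | h⟩ := slot_cases x
    · rw [h, Perm.mul_apply, rho_e0, rho_e0, swap_apply_self]; rfl
    · rw [h, Perm.mul_apply, rho_e1, rho_e1, swap_apply_self]; rfl
  have hinv2 : (rho k i)⁻¹ = rho k i := inv_eq_of_mul_eq_one_left hinv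
  have hsymm : ∀ (σ : Perm (Fin (2*(k+1)))) x, (σ * rho k i).symm x = rho k i (σ.symm x) := by
    intro σ x
    rw [Equiv.symm_apply_eq, Perm.mul_apply, ← Perm.mul_apply (rho k i), hinv]; simp
  refine Finset.sum_nbij' (fun σ => σ * rho k i) (fun σ => σ * rho k i) ?_ ?_ ?_ ?_ ?_
  · intro σ hσ
    simpa [hsymm, rho_div] using hσ
  · intro σ hσ
    simp only [Finset.mem_filter, Finset.mem_univ, true_and, hsymm] at hσ ⊢
    have hrr : ∀ x, rho k i (rho k i x) = x := fun x => by rw [← Perm.mul_apply, hinv]; rfl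
    rw [← rho_div k i, ← rho_div k i, hrr, hrr]
    exact hσ
  · intro σ _; simp [mul_assoc, hinv]
  · intro σ _; simp [mul_assoc, hinv]
  · intro σ _
    rw [Perm.sign_mul, rho_sign, mul_one]
    congr 1
    rw [← Equiv.prod_comp (swap i (Fin.last k))]
    simp only [Perm.mul_apply, rho_e0, rho_e1]

lemma MM_step (k : ℕ) (K : Fin (k+1) → Fin (2*(k+1)) → Fin (2*(k+1)) → ℤ)
    (hK : ∀ i x y, K i x y = - K i y x)
    (hs : ∀ i x, x ≠ hi k 0 → x ≠ hi k 1 → K i (hi k 0) x = K i (hi k 1) x) :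
    MM (k+1) K = ∑ i, 2 * K i (hi k 0) (hi k 1) *
      MM k (fun j x y => K (swap i (Fin.last k) j.castSucc) (low x) (low y)) := by
  simp only [← sum_pair_i k K hK]
  have hne : hi k 0 ≠ hi k 1 := by simp [hi]
  unfold MM
  rw [← Finset.sum_filter_add_sum_filter_not Finset.univ
    (fun σ : Perm (Fin (2*(k+1))) => (σ.symm (hi k 0)).val / 2 = (σ.symm (hi k 1)).val / 2)]
  have hz : ∑ σ : Perm (Fin (2*(k+1))) with
      ¬ (σ.symm (hi k 0)).val / 2 = (σ.symm (hi k 1)).val / 2,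
      (Perm.sign σ : ℤ) * ∏ i, K i (σ (e0 i)) (σ (e1 i)) = 0 := by
    have hsy : ∀ (σ : Perm (Fin (2*(k+1)))) x,
        (swap (hi k 0) (hi k 1) * σ).symm x = σ.symm (swap (hi k 0) (hi k 1) x) := by
      intro σ x
      rw [Equiv.symm_apply_eq]; simp
    refine Finset.sum_involution (fun σ _ => swap (hi k 0) (hi k 1) * σ) ?_ ?_ ?_ ?_
    · intro σ hσ
      simp only [Finset.mem_filter, Finset.mem_univ, true_and] at hσ
      rw [Perm.sign_mul, Perm.sign_swap hne]
      have : ∏ i, K i ((swap (hi k 0) (hi k 1) * σ) (e0 i)) ((swap (hi k 0) (hi k 1) * σ) (e1 i))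
          = ∏ i, K i (σ (e0 i)) (σ (e1 i)) := by
        refine Finset.prod_congr rfl fun i _ => ?_
        simp only [Perm.mul_apply]
        have nb : ∀ a b, (a = hi k 0 ∧ b = hi k 1) ∨ (a = hi k 1 ∧ b = hi k 0) →
            ¬ (σ (e0 i) = a ∧ σ (e1 i) = b) := by
          rintro a b hab ⟨h1, h2⟩
          apply hσ
          have h1' := (Equiv.symm_apply_eq σ).2 h1.symm
          have h2' := (Equiv.symm_apply_eq σ).2 h2.symm
          rcases hab with ⟨rfl, rfl⟩ | ⟨rfl, rfl⟩ <;> rw [h1', h2', e0_div, e1_div]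
        have n1 := nb _ _ (Or.inl ⟨rfl, rfl⟩)
        have n2 := nb _ _ (Or.inr ⟨rfl, rfl⟩)
        have n3 : σ (e0 i) ≠ σ (e1 i) := fun h => e0_ne_e1 (σ.injective h)
        generalize σ (e0 i) = a at *
        generalize σ (e1 i) = b at *
        by_cases ha0 : a = hi k 0
        · subst ha0
          have hb1 : b ≠ hi k 1 := fun h => n1 ⟨rfl, h⟩
          rw [swap_apply_left, swap_apply_of_ne_of_ne n3.symm hb1]
          exact (hs i b n3.symm hb1).symm
        by_cases ha1 : a = hi k 1
        · subst ha1
          have hb1 : b ≠ hi k 0 := fun h => n2 ⟨rfl, h⟩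
          rw [swap_apply_right, swap_apply_of_ne_of_ne hb1 n3.symm]
          exact (hs i b hb1 n3.symm)
        rw [swap_apply_of_ne_of_ne ha0 ha1]
        by_cases hb0 : b = hi k 0
        · subst hb0
          rw [swap_apply_left, hK, hK i a, hs i a ha0 ha1]
        by_cases hb1 : b = hi k 1
        · subst hb1
          rw [swap_apply_right, hK, hK i a, hs i a ha0 ha1]
        rw [swap_apply_of_ne_of_ne hb0 hb1]
      rw [this]
      push_cast
      ring
    · intro σ _ _ h
      have := mul_eq_right.1 h
      rw [swap_eq_one_iff] at this
      exact hne this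
    · intro σ hσ
      simp only [Finset.mem_filter, Finset.mem_univ, true_and, hsy, swap_apply_left,
        swap_apply_right] at hσ ⊢
      exact fun h => hσ h.symm
    · intro σ _
      simp
  rw [hz, add_zero]
  rw [← Finset.sum_fiberwise (s := Finset.filter _ _) (g := fun σ : Perm (Fin (2*(k+1))) =>
    (⟨(σ.symm (hi k 0)).val / 2, by omega⟩ : Fin (k+1)))]
  refine Finset.sum_congr rfl fun i _ => ?_
  refine Finset.sum_congr ?_ fun _ _ => rfl
  ext σ
  simp only [Finset.mem_filter, Finset.mem_univ, true_and, Fin.ext_iff]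
  constructor
  · rintro ⟨h1, h2⟩; exact ⟨h2, by omega⟩
  · rintro ⟨h1, h2⟩; exact ⟨by omega, h1⟩

/-- the skew all-ones matrix of the half-open interval `[I.1, I.2)` -/
def JJ {n : ℕ} (I : ℕ × ℕ) (x y : Fin n) : ℤ :=
  if I.1 ≤ x.val ∧ x.val < I.2 ∧ I.1 ≤ y.val ∧ y.val < I.2 then
    (if x.val < y.val then 1 else if y.val < x.val then -1 else 0) else 0

lemma JJ_skew {n : ℕ} (I : ℕ × ℕ) (x y : Fin n) : JJ I x y = - JJ I y x := by
  unfold JJ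
  split_ifs <;> omega

def MI (k : ℕ) (f : Fin k → ℕ × ℕ) : ℤ := MM k (fun i => JJ (f i))

def red (s : ℕ) (I : ℕ × ℕ) : ℕ × ℕ :=
  (if I.1 ≤ s then I.1 else I.1 - 2, if I.2 ≤ s then I.2 else I.2 - 2)

/-- rotation of the points `s, …, 2k+1` -/
def rot (k s : ℕ) (hs : s + 1 < 2*(k+1)) : Perm (Fin (2*(k+1))) where
  toFun x := if x.val < s then x else
    if h : x.val + 1 < 2*(k+1) then ⟨x.val+1, h⟩ else ⟨s, by omega⟩
  invFun x := if x.val < s then x else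
    if x.val = s then ⟨2*k+1, by omega⟩ else ⟨x.val - 1, by omega⟩
  left_inv x := by
    have := x.isLt
    apply Fin.ext
    by_cases h1 : x.val < s
    · simp [h1]
    · by_cases h2 : x.val + 1 < 2*(k+1)
      · simp [h1, h2]
        split_ifs <;> simp <;> omega
      · simp [h1, h2]; omega
  right_inv x := by
    have := x.isLt
    apply Fin.ext
    by_cases h1 : x.val < s
    · simp [h1]
    · by_cases h2 : x.val = s
      · simp only [if_neg h1, if_pos h2]
        rw [if_neg (by simp; omega), dif_neg (by simp; omega)]
        exact h2.symm
      · simp only [h1, h2, if_false]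
        split_ifs <;> simp <;> omega

def tau (k s : ℕ) (hs : s + 1 < 2*(k+1)) : Perm (Fin (2*(k+1))) := rot k s hs * rot k s hs

lemma rot_val (k s : ℕ) (hs : s + 1 < 2*(k+1)) (x : Fin (2*(k+1))) :
    (rot k s hs x).val = if x.val < s then x.val else if x.val + 1 < 2*(k+1) then x.val+1 else s := by
  simp only [rot, Equiv.coe_fn_mk]
  split_ifs <;> rfl

lemma tau_val (k s : ℕ) (hs : s + 1 < 2*(k+1)) (x : Fin (2*(k+1))) :
    (tau k s hs x).val = if x.val < s then x.val else if x.val < 2*k then x.val+2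
      else if x.val = 2*k then s else s+1 := by
  have := x.isLt
  simp only [tau, Perm.mul_apply, rot_val]
  split_ifs <;> omega

lemma tau_sign (k s : ℕ) (hs : s + 1 < 2*(k+1)) : Perm.sign (tau k s hs) = 1 := by
  rw [tau, Perm.sign_mul, Int.units_mul_self]

lemma MM_perm (k : ℕ) (K : Fin k → Fin (2*k) → Fin (2*k) → ℤ) (τ : Perm (Fin (2*k)))
    (hτ : Perm.sign τ = 1) : MM k K = MM k (fun i x y => K i (τ x) (τ y)) := by
  unfold MM
  rw [← Equiv.sum_comp (Equiv.mulLeft τ)]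
  refine Finset.sum_congr rfl fun σ _ => ?_
  simp [hτ]

lemma MI_step (k s : ℕ) (hs : s + 1 < 2*(k+1)) (f : Fin (k+1) → ℕ × ℕ)
    (hf : ∀ i, (f i).1 ≠ s+1 ∧ (f i).2 ≠ s+1) :
    MI (k+1) f = ∑ i, 2 * (if (f i).1 ≤ s ∧ s + 1 < (f i).2 then 1 else 0) *
      MI k (fun j => red s (f (swap i (Fin.last k) j.castSucc))) := by
  unfold MI
  rw [MM_perm (k+1) _ (tau k s hs) (tau_sign k s hs), MM_step]
  · refine Finset.sum_congr rfl fun i _ => ?_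
    congr 1
    · congr 1
      have := hf i
      simp only [JJ, tau_val, hi]
      simp
      split_ifs <;> omega
    · congr 1
      funext j x y
      have := hf (swap i (Fin.last k) j.castSucc)
      show JJ (f (swap i (Fin.last k) j.castSucc)) _ _ =
        JJ (red s (f (swap i (Fin.last k) j.castSucc))) x y
      generalize f (swap i (Fin.last k) j.castSucc) = I at *
      have hx := x.isLt
      have hy := y.isLt
      simp only [JJ, tau_val, low, red, hx, hy, if_true]
      congr 1
      · apply propext
        split_ifs <;> omega
      · split_ifs <;> omega
  · intro i x y; exact JJ_skew _ _ _
  · intro i x h0 h1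
    have hx := x.isLt
    have h0' : x.val ≠ 2*k := fun h => h0 (Fin.ext h)
    have h1' : x.val ≠ 2*k+1 := fun h => h1 (Fin.ext h)
    have hx2 : x.val < 2*k := by omega
    have := hf i
    simp only [JJ, tau_val, hi]
    simp [hx2]
    split_ifs <;> omega

lemma MI_zero_of_uncovered (k : ℕ) (f : Fin k → ℕ × ℕ) (z : Fin (2*k))
    (h : ∀ i, ¬ ((f i).1 ≤ z.val ∧ z.val < (f i).2)) : MI k f = 0 := by
  unfold MI MM
  refine Finset.sum_eq_zero fun σ _ => ?_
  obtain ⟨j, _, hj⟩ := slot_cases (σ.symm z)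
  rw [Finset.prod_eq_zero (Finset.mem_univ j), mul_zero]
  have := h j
  rcases hj with hj | hj
  · have e : σ (e0 j) = z := by rw [← hj]; simp
    rw [e]; simp only [JJ]; rw [if_neg]; tauto
  · have e : σ (e1 j) = z := by rw [← hj]; simp
    rw [e]; simp only [JJ]; rw [if_neg]; tauto

lemma MI_zero (f : Fin 0 → ℕ × ℕ) : MI 0 f = 1 := by
  unfold MI MM
  have : (Finset.univ : Finset (Perm (Fin (2*0)))) = {1} := by decide
  rw [this]; simp

lemma MI_nonneg : ∀ (k : ℕ) (f : Fin k → ℕ × ℕ), 0 ≤ MI k f := by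
  intro k
  induction k with
  | zero => intro f; rw [MI_zero]; norm_num
  | succ k ih =>
    intro f
    by_cases hfree : ∃ s, s + 1 < 2*(k+1) ∧ ∀ i, (f i).1 ≠ s+1 ∧ (f i).2 ≠ s+1
    · obtain ⟨s, hs, hf⟩ := hfree
      rw [MI_step k s hs f hf]
      refine Finset.sum_nonneg fun i _ => mul_nonneg ?_ (ih _)
      split_ifs <;> norm_num
    · by_cases h0 : ∃ i, (f i).1 ≤ 0 ∧ 0 < (f i).2
      · by_cases h1 : ∃ i, (f i).1 ≤ 2*k+1 ∧ 2*k+1 < (f i).2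
        · exfalso
          obtain ⟨i0, hi0, _⟩ := h0
          obtain ⟨i1, _, hi1⟩ := h1
          let U : Finset ℕ := Finset.univ.image (fun i => (f i).1) ∪ Finset.univ.image (fun i => (f i).2)
          have hU : U.card ≤ 2*(k+1) := by
            refine (Finset.card_union_le _ _).trans ?_
            have a := Finset.card_image_le (s := Finset.univ) (f := fun i => (f i).1)
            have b := Finset.card_image_le (s := Finset.univ) (f := fun i => (f i).2)
            simp at a b
            omega
          have hsub : insert (f i1).2 (Finset.range (2*(k+1))) ⊆ U := by
            intro x hx
            simp only [Finset.mem_insert, Finset.mem_range] at hx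
            simp only [U, Finset.mem_union, Finset.mem_image, Finset.mem_univ, true_and]
            rcases hx with rfl | hx
            · exact Or.inr ⟨i1, rfl⟩
            · rcases Nat.eq_zero_or_pos x with rfl | hpos
              · exact Or.inl ⟨i0, by omega⟩
              · by_contra hc
                apply hfree
                refine ⟨x-1, by omega, fun i => ⟨fun h => hc (Or.inl ⟨i, by omega⟩),
                  fun h => hc (Or.inr ⟨i, by omega⟩)⟩⟩
          have := Finset.card_le_card hsub
          rw [Finset.card_insert_of_notMem (by simp; omega), Finset.card_range] at this
          omega
        · rw [MI_zero_of_uncovered (k+1) f ⟨2*k+1, by omega⟩ (fun i h => h1 ⟨i, h⟩)]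
      · rw [MI_zero_of_uncovered (k+1) f ⟨0, by omega⟩ (fun i h => h0 ⟨i, h⟩)]

lemma MI_pos : ∀ (k : ℕ) (f : Fin k → ℕ × ℕ), (∀ i, f i = (0, 2*k)) → 0 < MI k f := by
  intro k
  induction k with
  | zero => intro f _; rw [MI_zero]; norm_num
  | succ k ih =>
    intro f hf
    rw [MI_step k 0 (by omega) f (by
      intro i; rw [hf]; exact ⟨by simp, by show 2*(k+1) ≠ 0+1; omega⟩)]
    refine Finset.sum_pos (fun i _ => mul_pos ?_ (ih _ ?_)) Finset.univ_nonempty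
    · rw [hf, if_pos ⟨le_rfl, by show 0+1 < 2*(k+1); omega⟩]; norm_num
    · intro j; rw [hf]; simp [red]; omega

open Finset in
/-- double telescoping -/
lemma telescope (n : ℕ) (G : ℕ → ℕ → ℝ) (hG0 : ∀ b, G 0 b = 0) (hGn : ∀ a, G a n = 0)
    (i j : ℕ) (hi : i < n) (hj : j < n) :
    ∑ p : Fin n × Fin n, (if p.1.val ≤ i ∧ j ≤ p.2.val then
      (G (p.1+1) p.2 - G p.1 p.2 - G (p.1+1) (p.2+1) + G p.1 (p.2+1)) else 0) = G (i+1) j := by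
  have hb : ∀ D : ℕ → ℝ, ∀ m, ∑ b ∈ range m, (if j ≤ b then D b - D (b+1) else 0)
      = if j ≤ m then D j - D m else 0 := by
    intro D m
    induction m with
    | zero =>
      split_ifs with h
      · have : j = 0 := by omega
        subst this; simp
      · simp
    | succ m ih =>
      rw [sum_range_succ, ih]
      by_cases h1 : j ≤ m
      · rw [if_pos h1, if_pos h1, if_pos (by omega)]; ring
      · rw [if_neg h1, if_neg h1]
        by_cases h2 : j ≤ m + 1
        · have : j = m + 1 := by omega
          rw [if_pos h2, this]; ring
        · rw [if_neg h2]; ring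
  have ha : ∀ D : ℕ → ℝ, ∀ m, ∑ a ∈ range m, (if a ≤ i then D (a+1) - D a else 0)
      = D (min m (i+1)) - D 0 := by
    intro D m
    induction m with
    | zero => simp
    | succ m ih =>
      rw [sum_range_succ, ih]
      by_cases h1 : m ≤ i
      · rw [if_pos h1, min_eq_left (by omega), min_eq_left (by omega)]; ring
      · rw [if_neg h1, min_eq_right (by omega), min_eq_right (by omega)]; ring
  rw [Fintype.sum_prod_type]
  have e1 : ∀ a : Fin n, ∑ b : Fin n, (if a.val ≤ i ∧ j ≤ b.val then
      (G (a+1) b - G a b - G (a+1) (b+1) + G a (b+1)) else 0)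
      = if a.val ≤ i then G (a+1) j - G a j else 0 := by
    intro a
    rw [Fin.sum_univ_eq_sum_range (fun b => if a.val ≤ i ∧ j ≤ b then
      (G (a+1) b - G a b - G (a+1) (b+1) + G a (b+1)) else 0) n]
    by_cases h : a.val ≤ i
    · have := hb (fun b => G (a+1) b - G a b) n
      rw [if_pos hj.le] at this
      simp only [h, true_and, if_true]
      simp only [hGn, sub_zero] at this
      rw [← this]
      refine sum_congr rfl fun b _ => ?_
      split_ifs
      · ring
      · rfl
    · simp [h]
  simp only [e1]
  rw [Fin.sum_univ_eq_sum_range (fun a => if a ≤ i then G (a+1) j - G a j else 0) n,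
    ha (fun a => G a j) n, min_eq_right (by omega), hG0, sub_zero]

lemma convex_ineq (x u v : ℝ) (hx : 0 < x) (hu : 0 < u) (hv : 0 < v) :
    0 ≤ 1/x^2 - 1/(x+u)^2 - 1/(x+v)^2 + 1/(x+u+v)^2 := by
  have h : ∀ y : ℝ, 0 < y → 1/y^2 - 1/(y+u)^2 = u * (1/(y*(y+u)^2) + 1/(y^2*(y+u))) := by
    intro y hy
    have : 0 < y + u := by positivity
    field_simp
    ring
  have h1 := h x hx
  have h2 := h (x+v) (by positivity)
  have h3 : u * (1/((x+v)*((x+v)+u)^2) + 1/((x+v)^2*((x+v)+u)))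
      ≤ u * (1/(x*(x+u)^2) + 1/(x^2*(x+u))) := by
    gcongr <;> linarith
  have h4 : x + v + u = x + u + v := by ring
  rw [h4] at h2 h3
  linarith

lemma mono_ineq (x u : ℝ) (hx : 0 < x) (hu : 0 < u) : 0 ≤ 1/x^2 - 1/(x+u)^2 := by
  have : 1/(x+u)^2 ≤ 1/x^2 := by gcongr; linarith
  linarith

/-- general positivity of the Pfaffian sum -/
lemma pf_sum_pos (k : ℕ) (q : Fin (2*k) → ℝ) (hq : StrictAnti q)
    (Q : Fin (2*k) → Fin (2*k) → ℝ)
    (hQ1 : ∀ i j, i < j → Q i j = 1/(q i - q j)^2)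
    (hQ2 : ∀ i j, Q i j = - Q j i) :
    0 < ∑ σ : Perm (Fin (2*k)), ((Perm.sign σ : ℤ) : ℝ) * ∏ i : Fin k, Q (σ (e0 i)) (σ (e1 i)) := by
  let G : ℕ → ℕ → ℝ := fun a b => if h : 0 < a ∧ a ≤ b ∧ b < 2*k then
    1/(q ⟨a-1, by omega⟩ - q ⟨b, by omega⟩)^2 else 0
  let w : Fin (2*k) × Fin (2*k) → ℝ := fun p => if p.1 < p.2 then
    (G (p.1+1) p.2 - G p.1 p.2 - G (p.1+1) (p.2+1) + G p.1 (p.2+1)) else 0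
  let I : Fin (2*k) × Fin (2*k) → ℕ × ℕ := fun p => (p.1.val, p.2.val + 1)
  have hw : ∀ p, 0 ≤ w p := by
    rintro ⟨a, b⟩
    simp only [w]
    split_ifs with hab
    swap
    · exact le_rfl
    have hab' : a.val < b.val := hab
    have hx := sub_pos.2 (hq hab)
    have hb := b.isLt
    simp only [G]
    rw [dif_pos (show 0 < a.val+1 ∧ a.val+1 ≤ b.val ∧ b.val < 2*k by omega)]
    by_cases h1 : 0 < a.val
    · have hu : 0 < q ⟨a.val-1, by omega⟩ - q a := sub_pos.2 (hq (by rw [Fin.lt_def]; simp; omega))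
      by_cases h2 : b.val + 1 < 2*k
      · have hv : 0 < q b - q ⟨b.val+1, h2⟩ := sub_pos.2 (hq (by rw [Fin.lt_def]; simp))
        rw [dif_pos (by omega), dif_pos (by omega), dif_pos (by omega)]
        have := convex_ineq _ _ _ hx hu hv
        convert this using 6 <;> simp
      · rw [dif_pos (by omega), dif_neg (by omega), dif_neg (by omega)]
        have := mono_ineq _ _ hx hu
        simp only [sub_zero, add_zero]
        convert this using 4 <;> simp
    · by_cases h2 : b.val + 1 < 2*k
      · have hv : 0 < q b - q ⟨b.val+1, h2⟩ := sub_pos.2 (hq (by rw [Fin.lt_def]; simp))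
        rw [dif_neg (by omega), dif_pos (by omega), dif_neg (by omega)]
        have := mono_ineq _ _ hx hv
        simp only [sub_zero, add_zero]
        convert this using 4 <;> simp
      · rw [dif_neg (by omega), dif_neg (by omega), dif_neg (by omega)]
        simp only [sub_zero, add_zero]
        positivity
  have hdec1 : ∀ i j, i < j → Q i j = ∑ p, w p * (JJ (I p) i j : ℝ) := by
    intro i j hij
    have hij' : i.val < j.val := hij
    have hj := j.isLt
    have ht := telescope (2*k) G (fun b => by simp [G]) (fun a => by simp [G]) i j i.isLt j.isLt
    have hg : G (i.val+1) j.val = Q i j := by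
      rw [hQ1 i j hij]
      simp only [G]
      rw [dif_pos (by omega)]
      simp
    rw [← hg, ← ht]
    refine Finset.sum_congr rfl fun p _ => ?_
    simp only [w, JJ, I]
    by_cases h : p.1.val ≤ i.val ∧ j.val ≤ p.2.val
    · rw [if_pos h, if_pos (show p.1 < p.2 by rw [Fin.lt_def]; omega), if_pos (by omega), if_pos hij']
      simp
    · have h' : ¬ (p.1.val ≤ i.val ∧ i.val < p.2.val+1 ∧ p.1.val ≤ j.val ∧ j.val < p.2.val+1) := by
        omega
      rw [if_neg h, if_neg h']; simp
  have hdec : ∀ i j, Q i j = ∑ p, w p * (JJ (I p) i j : ℝ) := by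
    intro i j
    rcases lt_trichotomy i j with h | h | h
    · exact hdec1 i j h
    · subst h
      have h1 : Q i i = 0 := by have := hQ2 i i; linarith
      rw [h1]
      symm
      refine Finset.sum_eq_zero fun p _ => ?_
      simp [JJ]
    · rw [hQ2, hdec1 j i h, ← Finset.sum_neg_distrib]
      refine Finset.sum_congr rfl fun p _ => ?_
      rw [JJ_skew _ i j]; push_cast; ring
  have hexp : ∑ σ : Perm (Fin (2*k)), ((Perm.sign σ : ℤ) : ℝ) * ∏ i : Fin k, Q (σ (e0 i)) (σ (e1 i))
      = ∑ f : Fin k → Fin (2*k) × Fin (2*k), (∏ i, w (f i)) * (MI k (fun i => I (f i)) : ℝ) := by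
    simp only [hdec, Fintype.prod_sum, Finset.mul_sum]
    rw [Finset.sum_comm]
    refine Finset.sum_congr rfl fun f _ => ?_
    simp only [MI, MM]
    push_cast
    rw [Finset.mul_sum]
    refine Finset.sum_congr rfl fun σ _ => ?_
    rw [Finset.prod_mul_distrib]
    ring
  rw [hexp]
  have hnn : ∀ f ∈ (Finset.univ : Finset (Fin k → Fin (2*k) × Fin (2*k))),
      0 ≤ (∏ i, w (f i)) * (MI k (fun i => I (f i)) : ℝ) := fun f _ =>
    mul_nonneg (Finset.prod_nonneg fun i _ => hw _) (by exact_mod_cast MI_nonneg k _)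
  refine Finset.sum_pos' hnn ⟨fun i => (⟨0, by have := i.isLt; omega⟩, ⟨2*k-1, by have := i.isLt; omega⟩), Finset.mem_univ _, ?_⟩
  refine mul_pos (Finset.prod_pos fun i _ => ?_) ?_
  · have hk := i.isLt
    have hlt : (⟨0, by omega⟩ : Fin (2*k)) < ⟨2*k-1, by omega⟩ := by rw [Fin.lt_def]; simp; omega
    have hx := sub_pos.2 (hq hlt)
    simp only [w]
    rw [if_pos hlt]
    simp only [G]
    rw [dif_pos (by omega), dif_neg (by omega), dif_neg (by omega), dif_neg (by omega)]
    simp only [sub_zero, add_zero]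
    have : 0 < 1 / (q ⟨0, by omega⟩ - q ⟨2*k-1, by omega⟩)^2 := by positivity
    convert this using 6
  · have := MI_pos k (fun i => I (⟨0, by have := i.isLt; omega⟩, ⟨2*k-1, by have := i.isLt; omega⟩)) (by
      intro i
      simp only [I]
      have := i.isLt
      congr 1
      omega)
    exact_mod_cast this

end Aux

/-- for α = 1 and even n with 2 ≤ n ≤ 10, the Pfaffian of the matrix
`Q_{ij} = q_{ij}|q_{ij}|^{-3}` of an ordered collinear configuration is positive. -/
theorem stmt10 (n : ℕ) (hn : 2 ≤ n) (hn10 : n ≤ 10) (hne : Even n)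
    (q : Fin n → ℝ) (hq : StrictAnti q)
    (Q : Matrix (Fin n) (Fin n) ℝ)
    (hQ : ∀ i j, Q i j = (q i - q j) * |q i - q j| ^ (-(3 : ℝ))) :
    0 < Pf Q := by
  obtain ⟨k, hk⟩ := hne.two_dvd
  subst hk
  have hQ1 : ∀ i j, i < j → Q i j = 1/(q i - q j)^2 := by
    intro i j hij
    have hx := sub_pos.2 (hq hij)
    rw [hQ, abs_of_pos hx, Real.rpow_neg hx.le]
    have : (q i - q j) ^ (3 : ℝ) = (q i - q j)^3 := by exact_mod_cast Real.rpow_natCast _ 3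
    rw [this]
    field_simp
  have hQ2 : ∀ i j, Q i j = - Q j i := by
    intro i j
    rw [hQ, hQ, abs_sub_comm]; ring
  have key := pf_sum_pos k q hq Q hQ1 hQ2
  unfold Pf
  refine mul_pos (by positivity) ?_
  refine lt_of_lt_of_eq key (Finset.sum_congr rfl fun σ _ => ?_)
  congr 1
  exact (Fintype.prod_equiv (finCongr (show 2 * k / 2 = k by omega)) _ _ fun i => rfl).symm
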